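/- There exists an absolute constant C > 0 such that for every real B ≥ 16 and every squarefree positive integer d, the number of positive integers ℓ ≤ B with rad(ℓ) = d is at most exp( C·(log B)·(log log log B)/(log log B) ). -/

import Mathlib

open Finset

/-- The radical of a positive integer: the product of its distinct prime factors. -/
def rad (n : ℕ) : ℕ := ∏ p ∈ n.primeFactors, p

lemma factorial_card_le_prod (S : Finset ℕ) (hS : ∀ p ∈ S, 1 ≤ p) :
    (#S).factorial ≤ ∏ p ∈ S, p := by
  induction S using Finset.induction_on_max with
  | empty => simp
  | insert a S hlt ih =>
    have ha : a ∉ S := fun h => lt_irrefl a (hlt a h)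
    have ha1 : 1 ≤ a := hS a (mem_insert_self a S)
    have hcard : #S ≤ #(Ico 1 a) := card_le_card fun p hp =>
      mem_Ico.2 ⟨hS p (mem_insert_of_mem hp), hlt p hp⟩
    rw [Nat.card_Ico] at hcard
    rw [card_insert_of_notMem ha, prod_insert ha, Nat.factorial_succ]
    exact Nat.mul_le_mul (by omega) (ih fun p hp => hS p (mem_insert_of_mem hp))

lemma sum_Icc_exp_neg_pow_le {u : ℝ} (hu : 0 < u) (N : ℕ) :
    ∑ a ∈ Icc 1 N, Real.exp (-u) ^ a ≤ u⁻¹ := by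
  have hx : Real.exp (-u) * u ≤ 1 - Real.exp (-u) := by
    have h1 := Real.add_one_le_exp u
    have h2 : Real.exp (-u) * Real.exp u = 1 := by rw [← Real.exp_add]; simp
    nlinarith [Real.exp_pos (-u)]
  have key : (∑ a ∈ Icc 1 N, Real.exp (-u) ^ a) * u ≤ 1 - Real.exp (-u) ^ N := by
    induction N with
    | zero => simp
    | succ n ih =>
      rw [sum_Icc_succ_top (by omega), add_mul, pow_succ]
      nlinarith [mul_le_mul_of_nonneg_left hx (pow_nonneg (Real.exp_pos (-u)).le n)]
  rw [← one_div, le_div_iff₀ hu]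
  linarith [pow_nonneg (Real.exp_pos (-u)).le N]

lemma sum_factorization_mul_log_two_le {n : ℕ} (hn : n ≠ 0) :
    (∑ p ∈ n.primeFactors, (n.factorization p : ℝ)) * Real.log 2 ≤ Real.log n := by
  have h : (n : ℝ) = ∏ p ∈ n.primeFactors, (p : ℝ) ^ n.factorization p := by
    conv_lhs => rw [← Nat.prod_factorization_pow_eq_self hn]
    simp [Finsupp.prod]
  have hp : ∀ p ∈ n.primeFactors, (2 : ℝ) ≤ p := fun p hp => by
    exact_mod_cast (Nat.prime_of_mem_primeFactors hp).two_le
  rw [h, Real.log_prod fun p hp' => pow_ne_zero _ (by linarith [hp p hp']), sum_mul]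
  refine sum_le_sum fun p hp' => ?_
  rw [Real.log_pow]
  exact mul_le_mul_of_nonneg_left (Real.log_le_log (by norm_num) (hp p hp')) (by positivity)

/-- Rankin's bound for the number of integers up to `B` with a prescribed set of primes. -/
lemma card_primeFactors_eq_le {B s : ℝ} (hB : 0 ≤ B) (hs : 0 < s) (S : Finset ℕ) :
    (#{n ∈ Icc 1 ⌊B⌋₊ | n.primeFactors = S} : ℝ)
      ≤ Real.exp (s * Real.log B) * ((s * Real.log 2)⁻¹) ^ #S := by
  set N := ⌊B⌋₊
  set x := Real.exp (-(s * Real.log 2)) with hx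
  have hx0 : 0 < x := Real.exp_pos _
  set A := {n ∈ Icc 1 N | n.primeFactors = S} with hA
  have hu : 0 < s * Real.log 2 := mul_pos hs (Real.log_pos (by norm_num))
  have hterm : ∀ n ∈ A, (1 : ℝ) ≤ Real.exp (s * Real.log B) * ∏ p : S, x ^ n.factorization p := by
    intro n hn
    obtain ⟨hnN, rfl⟩ := mem_filter.1 hn
    obtain ⟨h1, h2⟩ := mem_Icc.1 hnN
    have hnB : (n : ℝ) ≤ B := (Nat.le_floor_iff hB).1 h2
    have h3 := sum_factorization_mul_log_two_le (n := n) (by omega)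
    have h4 : Real.log n ≤ Real.log B := Real.log_le_log (by exact_mod_cast h1) hnB
    rw [prod_coe_sort n.primeFactors fun p => x ^ n.factorization p, prod_pow_eq_pow_sum, hx,
      ← Real.exp_nat_mul, ← Real.exp_add]
    apply Real.one_le_exp
    push_cast
    nlinarith [mul_le_mul_of_nonneg_left (h3.trans h4) hs.le]
  have hinj : ∑ n ∈ A, ∏ p : S, x ^ n.factorization p
      ≤ ∑ f ∈ Fintype.piFinset (fun _ : S => Icc 1 N), ∏ p : S, x ^ f p := by
    have hinjOn : Set.InjOn (fun (n : ℕ) (p : S) => n.factorization p) A := by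
      intro m hm n hn hmn
      obtain ⟨hm1, hm2⟩ := mem_filter.1 (mem_coe.1 hm)
      obtain ⟨hn1, hn2⟩ := mem_filter.1 (mem_coe.1 hn)
      rw [mem_Icc] at hm1 hn1
      refine Nat.eq_of_factorization_eq (by omega) (by omega) fun p => ?_
      by_cases hp : p ∈ S
      · exact congrFun hmn ⟨p, hp⟩
      · rw [Finsupp.notMem_support_iff.1 (by rwa [Nat.support_factorization, hm2]),
          Finsupp.notMem_support_iff.1 (by rwa [Nat.support_factorization, hn2])]
    rw [← sum_image (f := fun f : S → ℕ => ∏ p : S, x ^ f p) hinjOn]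
    refine sum_le_sum_of_subset_of_nonneg ?_ fun f _ _ => by positivity
    intro f hf
    obtain ⟨n, hn, rfl⟩ := mem_image.1 hf
    obtain ⟨hn1, rfl⟩ := mem_filter.1 hn
    rw [mem_Icc] at hn1
    refine Fintype.mem_piFinset.2 fun p => mem_Icc.2 ⟨?_, ?_⟩
    · have hp : (p : ℕ) ∈ n.primeFactors := p.2
      generalize (p : ℕ) = q at hp ⊢
      rw [← Nat.support_factorization, Finsupp.mem_support_iff] at hp
      exact Nat.one_le_iff_ne_zero.2 hp
    · exact (Nat.factorization_lt _ (by omega)).le.trans hn1.2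
  calc (#A : ℝ) = ∑ n ∈ A, (1 : ℝ) := by simp
    _ ≤ ∑ n ∈ A, Real.exp (s * Real.log B) * ∏ p : S, x ^ n.factorization p := sum_le_sum hterm
    _ = Real.exp (s * Real.log B) * ∑ n ∈ A, ∏ p : S, x ^ n.factorization p := by rw [mul_sum]
    _ ≤ Real.exp (s * Real.log B) * ∏ _p : S, ∑ a ∈ Icc 1 N, x ^ a := by
      rw [prod_univ_sum]
      gcongr
    _ = Real.exp (s * Real.log B) * (∑ a ∈ Icc 1 N, x ^ a) ^ #S := by simp
    _ ≤ _ := by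
      gcongr
      exact sum_Icc_exp_neg_pow_le hu N

lemma le_four_mul_div_log_of_log_factorial_le {k : ℕ} {M : ℝ} (hM : 1 < M)
    (h : Real.log k.factorial ≤ M) : (k : ℝ) ≤ 4 * M / Real.log M := by
  have hs : 0 < √M := Real.sqrt_pos.2 (by linarith)
  have h1 := Real.pow_div_factorial_le_exp (√M) hs.le k
  have hf : (0 : ℝ) < k.factorial := by positivity
  have h2 := Real.log_le_log (by positivity) h1
  rw [Real.log_exp, Real.log_div (by positivity) hf.ne', Real.log_pow,
    Real.log_sqrt (by linarith)] at h2
  have h3 : √M ≤ M := Real.sqrt_le_iff.2 ⟨by linarith, by nlinarith⟩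
  rw [le_div_iff₀ (Real.log_pos hM)]
  linarith

lemma card_filter_rad_eq_le {B : ℝ} (hM : Real.exp 1 < Real.log B) (hB : 1 ≤ B) (d : ℕ) :
    (#{n ∈ Icc 1 ⌊B⌋₊ | rad n = d} : ℝ)
      ≤ Real.exp (Real.log B / Real.log (Real.log B)
          * (5 + 4 * Real.log (Real.log (Real.log B)))) := by
  set M := Real.log B with hMdef
  set T := Real.log M with hT
  have hM1 : 1 < M := (Real.one_lt_exp_iff.2 one_pos).trans hM
  have hT1 : 1 < T := (Real.lt_log_iff_exp_lt (by linarith)).2 hM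
  have hlogT : 0 < Real.log T := Real.log_pos hT1
  obtain hA | ⟨m, hm⟩ := ({n ∈ Icc 1 ⌊B⌋₊ | rad n = d}).eq_empty_or_nonempty
  · rw [hA]
    simpa using (Real.exp_pos _).le
  obtain ⟨hm1, hm2⟩ := mem_filter.1 hm
  rw [mem_Icc] at hm1
  set S := m.primeFactors with hS
  have hsub : {n ∈ Icc 1 ⌊B⌋₊ | rad n = d} ⊆ {n ∈ Icc 1 ⌊B⌋₊ | n.primeFactors = S} := by
    intro n hn
    obtain ⟨hn1, hn2⟩ := mem_filter.1 hn
    refine mem_filter.2 ⟨hn1, ?_⟩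
    have h : rad n = rad m := hn2.trans hm2.symm
    rw [hS, ← Nat.primeFactors_radical n, ← Nat.primeFactors_radical m,
      Nat.radical_eq_prod_primeFactors, Nat.radical_eq_prod_primeFactors]
    exact congrArg Nat.primeFactors h
  have hk : (#S : ℝ) ≤ 4 * M / T := by
    refine le_four_mul_div_log_of_log_factorial_le hM1 (Real.log_le_log (by positivity) ?_)
    have h1 : (#S).factorial ≤ m :=
      (factorial_card_le_prod S fun p hp => (Nat.prime_of_mem_primeFactors hp).one_le).trans
        (Nat.le_of_dvd hm1.1 (Nat.prod_primeFactors_dvd m))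
    exact (Nat.le_floor_iff (by linarith)).1 (h1.trans hm1.2)
  have hlog2 : 0 < Real.log 2 := Real.log_pos (by norm_num)
  have hbase : (T⁻¹ * Real.log 2)⁻¹ ≤ Real.exp (Real.log T + 1) := by
    rw [Real.exp_add, Real.exp_log (by linarith), mul_inv, inv_inv]
    have h2 : (Real.log 2)⁻¹ ≤ Real.exp 1 := by
      rw [inv_le_comm₀ hlog2 (Real.exp_pos 1), ← one_div, div_le_iff₀ (Real.exp_pos 1)]
      nlinarith [Real.log_two_gt_d9, Real.exp_one_gt_d9]
    gcongr
  calc (#{n ∈ Icc 1 ⌊B⌋₊ | rad n = d} : ℝ)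
      ≤ #{n ∈ Icc 1 ⌊B⌋₊ | n.primeFactors = S} := by exact_mod_cast card_le_card hsub
    _ ≤ Real.exp (T⁻¹ * M) * ((T⁻¹ * Real.log 2)⁻¹) ^ #S :=
      card_primeFactors_eq_le (by linarith) (by positivity) S
    _ ≤ Real.exp (T⁻¹ * M) * Real.exp (Real.log T + 1) ^ #S := by gcongr
    _ = Real.exp (T⁻¹ * M + #S * (Real.log T + 1)) := by
      rw [← Real.exp_nat_mul, ← Real.exp_add]
    _ ≤ Real.exp (T⁻¹ * M + 4 * M / T * (Real.log T + 1)) := by gcongr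
    _ = _ := by congr 1; ring

/-- There is an absolute constant C > 0 such that for every real B ≥ 16
and every squarefree positive integer d, the number of ℓ ≤ B with rad(ℓ) = d is at most
exp( C·(log B)·(log log log B)/(log log B) ). -/
theorem statement5 :
    ∃ C : ℝ, 0 < C ∧ ∀ B : ℝ, 16 ≤ B → ∀ d : ℕ, 0 < d → Squarefree d →
      (((Finset.Icc 1 ⌊B⌋₊).filter (fun ℓ => rad ℓ = d)).card : ℝ)
        ≤ Real.exp (C * Real.log B * Real.log (Real.log (Real.log B))
            / Real.log (Real.log B)) := by
  have h16 : Real.exp 1 < Real.log 16 := by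
    rw [show (16 : ℝ) = 2 ^ 4 by norm_num, Real.log_pow]
    push_cast
    linarith [Real.log_two_gt_d9, Real.exp_one_lt_d9]
  have h16' : 1 < Real.log (Real.log 16) :=
    (Real.lt_log_iff_exp_lt ((Real.exp_pos 1).trans h16)).2 h16
  set c := Real.log (Real.log (Real.log 16)) with hc
  have hc0 : 0 < c := Real.log_pos h16'
  refine ⟨5 / c + 4, by positivity, fun B hB d _ _ => ?_⟩
  have hM : Real.log 16 ≤ Real.log B := Real.log_le_log (by norm_num) hB
  have hM0 : 0 < Real.log 16 := (Real.exp_pos 1).trans h16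
  have hT : Real.log (Real.log 16) ≤ Real.log (Real.log B) := Real.log_le_log hM0 hM
  have hcT : c ≤ Real.log (Real.log (Real.log B)) := Real.log_le_log (by linarith) hT
  refine (card_filter_rad_eq_le (h16.trans_le hM) (by linarith) d).trans (Real.exp_le_exp.2 ?_)
  have h5 : 5 ≤ 5 / c * Real.log (Real.log (Real.log B)) := by
    rw [div_mul_eq_mul_div, le_div_iff₀ hc0]
    linarith
  calc Real.log B / Real.log (Real.log B) * (5 + 4 * Real.log (Real.log (Real.log B)))
      ≤ Real.log B / Real.log (Real.log B)
        * ((5 / c + 4) * Real.log (Real.log (Real.log B))) := by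
        refine mul_le_mul_of_nonneg_left (by linarith) (div_nonneg ?_ ?_) <;> linarith
    _ = _ := by ring
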